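/- Let f : ℝ → ℝ be infinitely differentiable on an open set U ⊆ ℝ with 0 ∉ U, and let n ≥ 0 be an integer. Then on U one has d²/dx² ((d/dx x⁻¹)ⁿ f)(x) = ((d/dx x⁻¹)ⁿ (f''))(x) − 2n ((d/dx x⁻¹)^{n+1} f)(x). -/

import Mathlib

noncomputable section

/-- The operator `(d/dx x⁻¹)ⁿ`: the `n`-fold iterate of `g ↦ (x ↦ (x⁻¹ * g x)')`. -/
def opB (n : ℕ) : (ℝ → ℝ) → ℝ → ℝ :=
  (fun g (x : ℝ) => deriv (fun t => t⁻¹ * g t) x)^[n]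

lemma opB_succ_apply (n : ℕ) (f : ℝ → ℝ) (x : ℝ) :
    opB (n + 1) f x = deriv (fun t => t⁻¹ * opB n f t) x := by
  simp only [opB, Function.iterate_succ_apply']

lemma ContDiffOn.deriv_of_isOpen_infty {U : Set ℝ} (hU : IsOpen U) {g : ℝ → ℝ}
    (hg : ContDiffOn ℝ (⊤ : ℕ∞) g U) : ContDiffOn ℝ (⊤ : ℕ∞) (deriv g) U :=
  ((contDiffOn_infty_iff_deriv_of_isOpen hU).1 hg).2

lemma ContDiffOn.hasDerivAt_of_isOpen_infty {U : Set ℝ} (hU : IsOpen U) {g : ℝ → ℝ}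
    (hg : ContDiffOn ℝ (⊤ : ℕ∞) g U) {x : ℝ} (hx : x ∈ U) : HasDerivAt g (deriv g x) x :=
  (((contDiffOn_infty_iff_deriv_of_isOpen hU).1 hg).1.differentiableAt
    (hU.mem_nhds hx)).hasDerivAt

lemma ContDiffOn.inv_id_mul {U : Set ℝ} (hU0 : (0 : ℝ) ∉ U) {g : ℝ → ℝ}
    (hg : ContDiffOn ℝ (⊤ : ℕ∞) g U) : ContDiffOn ℝ (⊤ : ℕ∞) (fun t => t⁻¹ * g t) U :=
  (contDiffOn_id.inv fun _ hx h => hU0 (h ▸ hx)).mul hg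

lemma ContDiffOn.opB {U : Set ℝ} (hU : IsOpen U) (hU0 : (0 : ℝ) ∉ U) {f : ℝ → ℝ}
    (hf : ContDiffOn ℝ (⊤ : ℕ∞) f U) (n : ℕ) : ContDiffOn ℝ (⊤ : ℕ∞) (opB n f) U := by
  induction n with
  | zero => exact hf
  | succ n ih =>
    exact ((ih.inv_id_mul hU0).deriv_of_isOpen_infty hU).congr fun x _ => opB_succ_apply n f x

/-- The commutation rule `[d²/dx², x⁻¹] = -2 x⁻¹ (d/dx x⁻¹)` on smooth functions. -/
lemma deriv_deriv_inv_mul {U : Set ℝ} (hU : IsOpen U) (hU0 : (0 : ℝ) ∉ U) {g : ℝ → ℝ}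
    (hg : ContDiffOn ℝ (⊤ : ℕ∞) g U) {x : ℝ} (hx : x ∈ U) :
    deriv (deriv fun t => t⁻¹ * g t) x
      = x⁻¹ * deriv (deriv g) x - 2 * (x⁻¹ * deriv (fun t => t⁻¹ * g t) x) := by
  have hne : ∀ y ∈ U, y ≠ 0 := fun y hy h => hU0 (h ▸ hy)
  have deriv_eq : Set.EqOn (deriv fun t => t⁻¹ * g t)
      (fun y => -(y ^ 2)⁻¹ * g y + y⁻¹ * deriv g y) U := fun y hy =>
    ((hasDerivAt_inv (hne y hy)).mul (hg.hasDerivAt_of_isOpen_infty hU hy)).deriv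
  have hx0 := hne x hx
  have hsq : HasDerivAt (fun y : ℝ => -(y ^ 2)⁻¹) (2 * (x ^ 3)⁻¹) x := by
    refine ((hasDerivAt_pow 2 x).fun_inv (pow_ne_zero 2 hx0)).fun_neg.congr_deriv ?_
    field_simp
    norm_num [mul_comm]
  have deriv2 := (hsq.fun_mul (hg.hasDerivAt_of_isOpen_infty hU hx)).fun_add
    ((hasDerivAt_inv hx0).fun_mul
      ((hg.deriv_of_isOpen_infty hU).hasDerivAt_of_isOpen_infty hU hx))
  rw [deriv_eq.deriv hU hx, deriv2.deriv, deriv_eq hx]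
  field_simp
  ring

/-- **Lemma (ii).** For `f` smooth on an open set `U` not containing `0`,
`d²/dx² ((d/dx x⁻¹)ⁿ f) = (d/dx x⁻¹)ⁿ (f'') − 2n (d/dx x⁻¹)^{n+1} f` on `U`. -/
theorem opB_second_deriv (U : Set ℝ) (hU : IsOpen U) (hU0 : (0 : ℝ) ∉ U)
    (f : ℝ → ℝ) (hf : ContDiffOn ℝ (⊤ : ℕ∞) f U) (n : ℕ) :
    ∀ x ∈ U,
      deriv (deriv (opB n f)) x
        = opB n (deriv (deriv f)) x - 2 * n * opB (n + 1) f x := by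
  induction n with
  | zero => intro x _; simp [opB]
  | succ n ih =>
    intro x hx
    have smooth {g : ℝ → ℝ} (hg : ContDiffOn ℝ (⊤ : ℕ∞) g U) (m : ℕ) :
        HasDerivAt (fun t => t⁻¹ * opB m g t) (opB (m + 1) g x) x := by
      rw [opB_succ_apply]
      exact ((hg.opB hU hU0 m).inv_id_mul hU0).hasDerivAt_of_isOpen_infty hU hx
    have expand : Set.EqOn (deriv (deriv fun t => t⁻¹ * opB n f t))
        (fun t => t⁻¹ * opB n (deriv (deriv f)) t
          - (2 * n + 2) * (t⁻¹ * opB (n + 1) f t)) U := by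
      intro y hy
      rw [deriv_deriv_inv_mul hU hU0 (hf.opB hU hU0 n) hy, ih y hy, ← opB_succ_apply]
      ring
    have hf2 := (hf.deriv_of_isOpen_infty hU).deriv_of_isOpen_infty hU
    rw [show opB (n + 1) f = deriv fun t => t⁻¹ * opB n f t from
      funext (opB_succ_apply n f), expand.deriv hU hx,
      ((smooth hf2 n).fun_sub ((smooth hf (n + 1)).const_mul (2 * (n : ℝ) + 2))).deriv]
    push_cast
    ring

end
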